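/- With P, P', Q and the scoring vector s as in the p-valued construction with the 3q-block of largest values (described in the context), the distinguished candidate c is a possible winner of the partial profile P ∪ Q under s if and only if the 3DM instance is positive. -/

import Mathlib

/-- The score of candidate `c` in a profile (a list of votes) under scoring vector `s`.
A vote assigns each candidate a position in `Fin m` (position `0` being most preferred). -/
def score {C : Type*} {m : ℕ} (s : Fin m → ℕ) (P : List (C ≃ Fin m)) (c : C) : ℕ :=
  (P.map fun T => s (T c)).sum

/-- `prefL n ℓ k` is the sum of the block lengths `ℓ j` over `j < k`:
the (0-indexed) first position of the `k`-th block of the scoring vector. -/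
def prefL (n : ℕ) (ℓ : Fin n → ℕ) (k : ℕ) : ℕ :=
  ∑ j : Fin n, if (j : ℕ) < k then ℓ j else 0

/-- Candidates of Reduction 2 (case `u = 1`): the element candidates of `X`, `Y`, `Z`
(each of size `q`), the distinguished candidate `c`, the fresh candidate `w`, the
`n₁ = ℓ₂ − 1` dummies of `H₁` and the `n₂` dummies of `H'`. -/
inductive Cand2 (q n1 n2 : ℕ) where
  | x (i : Fin q)
  | y (i : Fin q)
  | z (i : Fin q)
  | c
  | w
  | h1 (k : Fin n1)
  | h2 (k : Fin n2)

open Finset in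
/-- Moving one alternative `x` inside a ranking shifts each other alternative by at most one. -/
theorem position_add_ite_eq {C : Type*} {m : ℕ} (f g : C ≃ Fin m) (x : C)
    (hord : ∀ u v, u ≠ x → v ≠ x → f u < f v → g u < g v) (u : C) (hu : u ≠ x) :
    (f u).val + (if g x < g u then 1 else 0) = (g u).val + (if f x < f u then 1 else 0) := by
  classical
  let _ : Fintype C := Fintype.ofEquiv _ f.symm
  have key : ∀ e : C ≃ Fin m,
      (e u).val = #{v | v ≠ x ∧ e v < e u} + (if e x < e u then 1 else 0) := by
    intro e
    have h1 : (e u).val = #{v | e v < e u} := by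
      rw [← Fin.card_Iio (e u)]
      refine (Finset.card_bij (fun v _ => e v) ?_ ?_ ?_).symm
      · simp
      · simp
      · intro r hr
        exact ⟨e.symm r, by simpa using hr, by simp⟩
    rw [h1, ← Finset.card_filter_add_card_filter_not (s := {v | e v < e u}) (fun v => v ≠ x)]
    congr 1
    · rw [Finset.filter_filter]
      simp only [and_comm]
    · rw [Finset.filter_filter]
      by_cases h : e x < e u
      · rw [if_pos h, Finset.card_eq_one]
        refine ⟨x, ?_⟩
        ext v
        simp only [mem_filter, mem_univ, true_and, mem_singleton, not_not]
        exact ⟨fun hv => hv.2, fun hv => ⟨hv ▸ h, hv⟩⟩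
      · rw [if_neg h, Finset.card_eq_zero]
        ext v
        simp only [mem_filter, mem_univ, true_and, not_not, notMem_empty, iff_false]
        rintro ⟨h1, rfl⟩
        exact h h1
  have hcard : #{v | v ≠ x ∧ f v < f u} = #{v | v ≠ x ∧ g v < g u} := by
    refine congrArg card (filter_congr fun v _ => and_congr_right fun hv => ⟨hord v u hv hu, fun h => ?_⟩)
    by_contra hle
    rcases (not_lt.mp hle).lt_or_eq with h2 | h2
    · exact absurd (hord u v hu hv h2) (not_lt.mpr h.le)
    · rw [f.injective h2] at h
      exact lt_irrefl _ h
  have hf := key f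
  have hg := key g
  rw [hcard] at hf
  omega

theorem score_ofFn_append {C : Type*} {m t : ℕ} (s : Fin m → ℕ) (T : Fin t → (C ≃ Fin m))
    (Q : List (C ≃ Fin m)) (d : C) :
    score s (List.ofFn T ++ Q) d = ∑ i, s (T i d) + score s Q d := by
  simp [score, List.map_ofFn, List.sum_ofFn]

theorem prefL_zero (n : ℕ) (ℓ : Fin n → ℕ) : prefL n ℓ 0 = 0 := by
  simp [prefL]

theorem prefL_succ (n : ℕ) (ℓ : Fin n → ℕ) (k : ℕ) (hk : k < n) :
    prefL n ℓ (k + 1) = prefL n ℓ k + ℓ ⟨k, hk⟩ := by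
  have h : ℓ ⟨k, hk⟩ = ∑ j : Fin n, if j = ⟨k, hk⟩ then ℓ j else 0 := by simp
  rw [prefL, prefL, h, ← Finset.sum_add_distrib]
  refine Finset.sum_congr rfl fun j _ => ?_
  simp only [Fin.ext_iff]
  split_ifs <;> omega

theorem prefL_mono (n : ℕ) (ℓ : Fin n → ℕ) : Monotone (prefL n ℓ) := by
  intro k k' h
  refine Finset.sum_le_sum fun j _ => ?_
  split_ifs <;> omega

theorem exists_block (n : ℕ) (ℓ : Fin n → ℕ) (r : ℕ) (hr : r < prefL n ℓ n) :
    ∃ j : Fin n, prefL n ℓ j ≤ r ∧ r < prefL n ℓ (j + 1) := by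
  have hex : ∃ k, r < prefL n ℓ k := ⟨n, hr⟩
  classical
  have h1 := Nat.find_spec hex
  have h2 : Nat.find hex ≤ n := Nat.find_min' hex hr
  have h3 : Nat.find hex ≠ 0 := by
    intro h
    rw [h, prefL_zero] at h1
    omega
  obtain ⟨k, hk⟩ := Nat.exists_eq_succ_of_ne_zero h3
  refine ⟨⟨k, by omega⟩, ?_, ?_⟩
  · exact not_lt.mp (Nat.find_min hex (m := k) (by omega))
  · rw [hk] at h1
    exact h1

/-- A scoring vector given blockwise by decreasing values is nonincreasing. -/
theorem antitone_of_blocks {p m : ℕ} {a : Fin p → ℕ} (ha : StrictAnti a) {ℓ : Fin p → ℕ}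
    (hm : m = prefL p ℓ p) {s : Fin m → ℕ}
    (hs : ∀ (pos : Fin m) (j : Fin p),
      prefL p ℓ (j : ℕ) ≤ (pos : ℕ) → (pos : ℕ) < prefL p ℓ ((j : ℕ) + 1) → s pos = a j) :
    Antitone s := by
  intro r r' h
  obtain ⟨j, hj1, hj2⟩ := exists_block p ℓ r (by omega)
  obtain ⟨j', hj1', hj2'⟩ := exists_block p ℓ r' (by omega)
  rw [hs r j hj1 hj2, hs r' j' hj1' hj2']
  refine ha.antitone ?_
  by_contra hlt
  have h1 : (j' : ℕ) + 1 ≤ j := not_le.mp hlt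
  have h2 := prefL_mono p ℓ h1
  have h3 : r.val ≤ r'.val := h
  omega

/-- The first three blocks of a nonincreasing scoring vector: value `a0` below position `b1`,
`a1` on `[b1, b2)`, `a2` on `[b2, b3)`, and smaller values from `b3` on. -/
structure HasTopBlocks {m : ℕ} (s : Fin m → ℕ) (b1 b2 b3 a0 a1 a2 : ℕ) : Prop where
  lt12 : b1 < b2
  lt23 : b2 < b3
  fst_gt : a1 < a0
  snd_gt : a2 < a1
  anti : Antitone s
  fst : ∀ r : Fin m, r.val < b1 → s r = a0
  snd : ∀ r : Fin m, b1 ≤ r.val → r.val < b2 → s r = a1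
  trd : ∀ r : Fin m, b2 ≤ r.val → r.val < b3 → s r = a2
  rest : ∀ r : Fin m, b3 ≤ r.val → s r < a2

theorem hasTopBlocks_of_blocks {p m : ℕ} (hp : 3 ≤ p) {a : Fin p → ℕ} (ha : StrictAnti a)
    {ℓ : Fin p → ℕ} (hℓ : ∀ j, 1 ≤ ℓ j) (hm : m = prefL p ℓ p) {s : Fin m → ℕ}
    (hs : ∀ (pos : Fin m) (j : Fin p),
      prefL p ℓ (j : ℕ) ≤ (pos : ℕ) → (pos : ℕ) < prefL p ℓ ((j : ℕ) + 1) → s pos = a j) :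
    HasTopBlocks s (ℓ ⟨0, by omega⟩) (ℓ ⟨0, by omega⟩ + ℓ ⟨1, by omega⟩)
      (ℓ ⟨0, by omega⟩ + ℓ ⟨1, by omega⟩ + ℓ ⟨2, by omega⟩)
      (a ⟨0, by omega⟩) (a ⟨1, by omega⟩) (a ⟨2, by omega⟩) := by
  have e0 := prefL_zero p ℓ
  have e1 := prefL_succ p ℓ 0 (by omega)
  have e2 := prefL_succ p ℓ 1 (by omega)
  have e3 := prefL_succ p ℓ 2 (by omega)
  simp only [Nat.reduceAdd, zero_add] at e1 e2 e3
  refine ⟨?_, ?_, ha (by simp), ha (by simp), antitone_of_blocks ha hm hs, ?_, ?_, ?_, ?_⟩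
  · have := hℓ ⟨1, by omega⟩
    omega
  · have := hℓ ⟨2, by omega⟩
    omega
  · intro r h
    exact hs r ⟨0, by omega⟩ (by simp only; omega) (by simp only [zero_add]; omega)
  · intro r h h'
    exact hs r ⟨1, by omega⟩ (by simp only; omega) (by simp only [Nat.reduceAdd]; omega)
  · intro r h h'
    exact hs r ⟨2, by omega⟩ (by simp only; omega) (by simp only [Nat.reduceAdd]; omega)
  · intro r h
    obtain ⟨j, hj1, hj2⟩ := exists_block p ℓ r (by omega)
    rw [hs r j hj1 hj2]
    refine ha ?_
    by_contra hle
    have h1 : (j : ℕ) + 1 ≤ 3 := by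
      have : (j : ℕ) ≤ 2 := not_lt.mp hle
      omega
    have := prefL_mono p ℓ h1
    omega

/-- A vote of the reduction for the triple `(x0, y0, z0)`: `x0` is at the last position before
`b1`, `y0` at `b1`, the dummies `h1` strictly between `b1` and `b2`, `z0` at `b2`, and the
dummies `h2` behind `b2`. -/
structure IsTripleVote {q n1 n2 m : ℕ} (f : Cand2 q n1 n2 ≃ Fin m) (b1 b2 : ℕ)
    (x0 y0 z0 : Fin q) : Prop where
  x : (f (Cand2.x x0)).val + 1 = b1
  y : (f (Cand2.y y0)).val = b1
  h1 : ∀ k, b1 < (f (Cand2.h1 k)).val ∧ (f (Cand2.h1 k)).val < b2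
  z : (f (Cand2.z z0)).val = b2
  h2 : ∀ k, b2 < (f (Cand2.h2 k)).val

namespace IsTripleVote

variable {q n1 n2 m b1 b2 : ℕ} {f g : Cand2 q n1 n2 ≃ Fin m} {x0 y0 z0 : Fin q}

open Finset in
/-- The special candidates and dummies fill all positions from that of `x0` on. -/
theorem pos_lt_or (hf : IsTripleVote f b1 b2 x0 y0 z0) (hb : b1 < b2)
    (hm : n2 + n1 + b1 + 2 = m) (d : Cand2 q n1 n2) :
    (f d).val + 1 < b1 ∨ d = Cand2.x x0 ∨ d = Cand2.y y0 ∨ d = Cand2.z z0 ∨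
      (∃ k, d = Cand2.h1 k) ∨ ∃ k, d = Cand2.h2 k := by
  classical
  by_cases hd : (f d).val + 1 < b1
  · exact Or.inl hd
  right
  have hx := hf.x
  have hy := hf.y
  have hz := hf.z
  let φ : Fin 3 ⊕ (Fin n1 ⊕ Fin n2) → Cand2 q n1 n2 :=
    Sum.elim ![Cand2.x x0, Cand2.y y0, Cand2.z z0] (Sum.elim Cand2.h1 Cand2.h2)
  have hφ : Function.Injective φ := by
    rintro (i | i | i) (j | j | j) h <;> simp only [φ, Sum.elim_inl, Sum.elim_inr] at h
    · fin_cases i <;> fin_cases j <;> simp_all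
    · fin_cases i <;> simp at h
    · fin_cases i <;> simp at h
    · fin_cases j <;> simp at h
    · simpa using h
    · simp at h
    · fin_cases j <;> simp at h
    · simp at h
    · simpa using h
  have hφge : ∀ a, (f (Cand2.x x0)) ≤ f (φ a) := by
    rintro (i | i | i)
    · rw [Fin.le_def]
      fin_cases i <;> simp [φ] <;> omega
    · have := hf.h1 i
      simp only [φ, Sum.elim_inl, Sum.elim_inr, Fin.le_def]
      omega
    · have := hf.h2 i
      simp only [φ, Sum.elim_inr, Fin.le_def]
      omega
  have himg : univ.image (fun a => f (φ a)) = Ici (f (Cand2.x x0)) := by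
    refine Finset.eq_of_subset_of_card_le ?_ ?_
    · intro r hr
      obtain ⟨a, -, rfl⟩ := mem_image.mp hr
      exact mem_Ici.mpr (hφge a)
    · rw [card_image_of_injective (f := fun a => f (φ a)) _ (f.injective.comp hφ), Fin.card_Ici]
      simp only [card_univ, Fintype.card_sum, Fintype.card_fin]
      omega
  have hmem : f d ∈ Ici (f (Cand2.x x0)) := by
    rw [mem_Ici, Fin.le_def]
    omega
  rw [← himg] at hmem
  obtain ⟨a, -, ha⟩ := mem_image.mp hmem
  have hda := f.injective ha
  subst hda
  rcases a with i | i | i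
  · fin_cases i <;> simp [φ]
  · simp [φ]
  · simp [φ]

/-- `g` ranks the candidates other than `x0` as `f` does. -/
def Completes (f g : Cand2 q n1 n2 ≃ Fin m) (x0 : Fin q) : Prop :=
  ∀ u v : Cand2 q n1 n2, u ≠ Cand2.x x0 → v ≠ Cand2.x x0 → f u < f v → g u < g v

theorem Completes.before (h : Completes f g x0) {u : Cand2 q n1 n2}
    (hu : f u < f (Cand2.x x0)) :
    (f u).val ≤ (g u).val ∧ (g u).val ≤ (f u).val + 1 := by
  have hne : u ≠ Cand2.x x0 := fun e => lt_irrefl _ (e ▸ hu)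
  have := position_add_ite_eq f g _ h u hne
  rw [if_neg (not_lt.mpr hu.le)] at this
  split_ifs at this <;> omega

theorem Completes.after (h : Completes f g x0) {u : Cand2 q n1 n2}
    (hu : f (Cand2.x x0) < f u) :
    ((f u).val ≤ (g (Cand2.x x0)).val ∧ (g u).val + 1 = (f u).val) ∨
      ((g (Cand2.x x0)).val < (f u).val ∧ (g u).val = (f u).val) := by
  have hne : u ≠ Cand2.x x0 := fun e => lt_irrefl _ (e ▸ hu)
  have hinj : (g u).val ≠ (g (Cand2.x x0)).val := fun e => hne (g.injective (Fin.ext e))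
  have := position_add_ite_eq f g _ h u hne
  rw [if_pos hu] at this
  simp only [Fin.lt_def] at this
  split_ifs at this <;> omega

variable {s : Fin m → ℕ} {b3 a0 a1 a2 : ℕ}

theorem value_of_before (hs : HasTopBlocks s b1 b2 b3 a0 a1 a2)
    (hf : IsTripleVote f b1 b2 x0 y0 z0) (hc : Completes f g x0) {d : Cand2 q n1 n2}
    (hd : (f d).val + 1 < b1) : s (g d) = s (f d) := by
  have hx := hf.x
  have := hc.before (u := d) (by rw [Fin.lt_def]; omega)
  rw [hs.fst (g d) (by omega), hs.fst (f d) (by omega)]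

theorem value_c (hs : HasTopBlocks s b1 b2 b3 a0 a1 a2)
    (hf : IsTripleVote f b1 b2 x0 y0 z0) (hm : n2 + n1 + b1 + 2 = m) (hc : Completes f g x0) :
    s (g Cand2.c) = s (f Cand2.c) := by
  have := hf.pos_lt_or hs.lt12 hm Cand2.c
  simp only [reduceCtorEq, exists_false, or_false] at this
  exact value_of_before hs hf hc this

theorem value_w (hs : HasTopBlocks s b1 b2 b3 a0 a1 a2)
    (hf : IsTripleVote f b1 b2 x0 y0 z0) (hm : n2 + n1 + b1 + 2 = m) (hc : Completes f g x0) :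
    s (g Cand2.w) = s (f Cand2.w) := by
  have := hf.pos_lt_or hs.lt12 hm Cand2.w
  simp only [reduceCtorEq, exists_false, or_false] at this
  exact value_of_before hs hf hc this

theorem value_h1 (hs : HasTopBlocks s b1 b2 b3 a0 a1 a2)
    (hf : IsTripleVote f b1 b2 x0 y0 z0) (hc : Completes f g x0) (k : Fin n1) :
    s (g (Cand2.h1 k)) = s (f (Cand2.h1 k)) := by
  have hx := hf.x
  have hk := hf.h1 k
  have := hc.after (u := Cand2.h1 k) (by rw [Fin.lt_def]; omega)
  rw [hs.snd (g _) (by omega) (by omega), hs.snd (f _) (by omega) (by omega)]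

theorem value_h2_le (hs : HasTopBlocks s b1 b2 b3 a0 a1 a2)
    (hf : IsTripleVote f b1 b2 x0 y0 z0) (hc : Completes f g x0) (k : Fin n2) :
    s (f (Cand2.h2 k)) ≤ s (g (Cand2.h2 k)) := by
  have hx := hf.x
  have hk := hf.h2 k
  have hlt := hs.lt12
  have := hc.after (u := Cand2.h2 k) (by rw [Fin.lt_def]; omega)
  refine hs.anti ?_
  rw [Fin.le_def]
  omega

theorem value_h2_eq (hs : HasTopBlocks s b1 b2 b3 a0 a1 a2)
    (hf : IsTripleVote f b1 b2 x0 y0 z0) (hc : Completes f g x0)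
    (hg : (g (Cand2.x x0)).val ≤ b2) (k : Fin n2) :
    s (g (Cand2.h2 k)) = s (f (Cand2.h2 k)) := by
  have hx := hf.x
  have hk := hf.h2 k
  have hlt := hs.lt12
  have := hc.after (u := Cand2.h2 k) (by rw [Fin.lt_def]; omega)
  congr 1
  exact Fin.ext (by omega)

/-- If no dummy behind `z0` gains, then `x0` is not moved beyond the third block. -/
theorem pos_x_lt (hs : HasTopBlocks s b1 b2 b3 a0 a1 a2)
    (hf : IsTripleVote f b1 b2 x0 y0 z0) (hm : n2 + n1 + b1 + 2 = m) (hc : Completes f g x0)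
    (hh : ∀ k, s (g (Cand2.h2 k)) ≤ s (f (Cand2.h2 k))) : (g (Cand2.x x0)).val < b3 := by
  by_contra hge
  have hx := hf.x
  have hy := hf.y
  have hz := hf.z
  have h12 := hs.lt12
  have h23 := hs.lt23
  obtain ⟨u, hu⟩ := f.surjective ⟨b3, by omega⟩
  have hu' : (f u).val = b3 := by rw [hu]
  rcases hf.pos_lt_or h12 hm u with h | rfl | rfl | rfl | ⟨k, rfl⟩ | ⟨k, rfl⟩
  · omega
  · omega
  · omega
  · omega
  · have := hf.h1 k
    omega
  · have h1 := hc.after (u := Cand2.h2 k) (by rw [Fin.lt_def]; omega)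
    have h2 := hs.trd (g (Cand2.h2 k)) (by omega) (by omega)
    have h3 := hs.rest (f (Cand2.h2 k)) (by omega)
    have := hh k
    omega

theorem value_y (hs : HasTopBlocks s b1 b2 b3 a0 a1 a2)
    (hf : IsTripleVote f b1 b2 x0 y0 z0) (hm : n2 + n1 + b1 + 2 = m) (hc : Completes f g x0)
    (v : Fin q) :
    s (g (Cand2.y v)) = s (f (Cand2.y v)) +
      if b1 ≤ (g (Cand2.x x0)).val ∧ y0 = v then a0 - a1 else 0 := by
  have hx := hf.x
  have hy := hf.y
  have h12 := hs.lt12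
  have hgt := hs.fst_gt
  by_cases hv : y0 = v
  · subst hv
    have h1 := hc.after (u := Cand2.y y0) (by rw [Fin.lt_def]; omega)
    rw [hs.snd (f _) (by omega) (by omega)]
    by_cases hb : b1 ≤ (g (Cand2.x x0)).val
    · rw [hs.fst (g _) (by omega), if_pos ⟨hb, rfl⟩]
      omega
    · rw [hs.snd (g _) (by omega) (by omega), if_neg (fun h => hb h.1)]
      omega
  · rw [if_neg (fun h => hv h.2)]
    have := hf.pos_lt_or hs.lt12 hm (Cand2.y v)
    simp only [reduceCtorEq, exists_false, or_false, Cand2.y.injEq, Ne.symm hv] at this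
    exact value_of_before hs hf hc this

theorem value_z (hs : HasTopBlocks s b1 b2 b3 a0 a1 a2)
    (hf : IsTripleVote f b1 b2 x0 y0 z0) (hm : n2 + n1 + b1 + 2 = m) (hc : Completes f g x0)
    (v : Fin q) :
    s (g (Cand2.z v)) = s (f (Cand2.z v)) +
      if b2 ≤ (g (Cand2.x x0)).val ∧ z0 = v then a1 - a2 else 0 := by
  have hx := hf.x
  have hz := hf.z
  have h12 := hs.lt12
  have h23 := hs.lt23
  have hgt := hs.snd_gt
  by_cases hv : z0 = v
  · subst hv
    have h1 := hc.after (u := Cand2.z z0) (by rw [Fin.lt_def]; omega)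
    rw [hs.trd (f _) (by omega) (by omega)]
    by_cases hb : b2 ≤ (g (Cand2.x x0)).val
    · rw [hs.snd (g _) (by omega) (by omega), if_pos ⟨hb, rfl⟩]
      omega
    · rw [hs.trd (g _) (by omega) (by omega), if_neg (fun h => hb h.1)]
      omega
  · rw [if_neg (fun h => hv h.2)]
    have := hf.pos_lt_or hs.lt12 hm (Cand2.z v)
    simp only [reduceCtorEq, exists_false, or_false, Cand2.z.injEq, Ne.symm hv] at this
    exact value_of_before hs hf hc this

theorem value_x (hs : HasTopBlocks s b1 b2 b3 a0 a1 a2)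
    (hf : IsTripleVote f b1 b2 x0 y0 z0) (hm : n2 + n1 + b1 + 2 = m) (hc : Completes f g x0)
    (hg : (g (Cand2.x x0)).val < b3) (v : Fin q) :
    s (g (Cand2.x v)) + ((if b1 ≤ (g (Cand2.x x0)).val ∧ x0 = v then a0 - a1 else 0) +
      if b2 ≤ (g (Cand2.x x0)).val ∧ x0 = v then a1 - a2 else 0) = s (f (Cand2.x v)) := by
  have hx := hf.x
  have h12 := hs.lt12
  have h23 := hs.lt23
  have hgt := hs.fst_gt
  have hgt' := hs.snd_gt
  by_cases hv : x0 = v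
  · subst hv
    rw [hs.fst (f _) (by omega)]
    by_cases hb : b1 ≤ (g (Cand2.x x0)).val
    · by_cases hb' : b2 ≤ (g (Cand2.x x0)).val
      · rw [hs.trd (g _) hb' hg, if_pos ⟨hb, rfl⟩, if_pos ⟨hb', rfl⟩]
        omega
      · rw [hs.snd (g _) hb (by omega), if_pos ⟨hb, rfl⟩, if_neg (fun h => hb' h.1)]
        omega
    · rw [hs.fst (g _) (by omega), if_neg (fun h => hb h.1), if_neg (fun h => hb (by omega))]
      omega
  · rw [if_neg (fun h => hv h.2), if_neg (fun h => hv h.2)]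
    have := hf.pos_lt_or hs.lt12 hm (Cand2.x v)
    simp only [reduceCtorEq, exists_false, or_false, Cand2.x.injEq, Ne.symm hv] at this
    exact value_of_before hs hf hc this

end IsTripleVote

/-- Any candidate of a vote can be moved back to any later position. -/
theorem exists_move_back {C : Type*} {m : ℕ} (f : C ≃ Fin m) (x : C) (r : Fin m) (hr : f x ≤ r) :
    ∃ g : C ≃ Fin m, g x = r ∧ ∀ u v, u ≠ x → v ≠ x → f u < f v → g u < g v := by
  have key : ∀ k : ℕ, ∀ r : Fin m, r.val = (f x).val + k →
      ∃ g : C ≃ Fin m, g x = r ∧ ∀ u v, u ≠ x → v ≠ x → f u < f v → g u < g v := by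
    intro k
    induction k with
    | zero =>
      intro r h
      exact ⟨f, Fin.ext h.symm, fun _ _ _ _ h => h⟩
    | succ k ih =>
      intro r h
      obtain ⟨g, hgx, hg⟩ := ih ⟨(f x).val + k, by omega⟩ rfl
      refine ⟨g.trans (Equiv.swap (g x) r), by simp, fun u v hu hv huv => ?_⟩
      have h1 := hg u v hu hv huv
      have hux : g u ≠ g x := fun e => hu (g.injective e)
      have hvx : g v ≠ g x := fun e => hv (g.injective e)
      have hgx' : (g x).val + 1 = r.val := by
        rw [hgx, h]
        simp only
        omega
      simp only [Equiv.trans_apply, Equiv.swap_apply_def, if_neg hux, if_neg hvx]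
      simp only [ne_eq, Fin.ext_iff] at hux hvx
      simp only [Fin.lt_def, Fin.ext_iff] at h1 ⊢
      split_ifs <;> omega
  rw [Fin.le_def] at hr
  exact key (r.val - (f x).val) r (by omega)

open Finset in
/-- The counting argument: the elements of `A` are spread over distinct `y`, those of `K` over
distinct `z`, and every `x` is charged `δ1 + δ2` in total. -/
theorem isMatching_of_weights {q t δ1 δ2 : ℕ} (h1 : 0 < δ1) (h2 : 0 < δ2)
    (S : Fin t → Fin q × Fin q × Fin q) {A K : Finset (Fin t)} (hKA : K ⊆ A)
    (hA : ∀ v, #{i ∈ A | (S i).2.1 = v} ≤ 1) (hK : ∀ v, #{i ∈ K | (S i).2.2 = v} ≤ 1)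
    (hx : ∀ v, δ1 + δ2 ≤ #{i ∈ A | (S i).1 = v} * δ1 + #{i ∈ K | (S i).1 = v} * δ2) :
    #K = q ∧ ∀ i ∈ K, ∀ j ∈ K, i ≠ j →
      (S i).1 ≠ (S j).1 ∧ (S i).2.1 ≠ (S j).2.1 ∧ (S i).2.2 ≠ (S j).2.2 := by
  have cardEq : ∀ (B : Finset (Fin t)) (π : Fin t → Fin q), #B = ∑ v, #{i ∈ B | π i = v} :=
    fun B π => card_eq_sum_card_fiberwise (fun _ _ => mem_univ _)
  have hAq : #A ≤ q := by
    rw [cardEq A fun i => (S i).2.1]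
    simpa using sum_le_sum fun v (_ : v ∈ univ) => hA v
  have hKq : #K ≤ q := by
    rw [cardEq K fun i => (S i).2.2]
    simpa using sum_le_sum fun v (_ : v ∈ univ) => hK v
  have hsum : q * (δ1 + δ2) ≤ #A * δ1 + #K * δ2 := by
    rw [cardEq A fun i => (S i).1, cardEq K fun i => (S i).1, sum_mul, sum_mul,
      ← sum_add_distrib]
    simpa using sum_le_sum fun v (_ : v ∈ univ) => hx v
  have hK_eq : #K = q := by
    refine le_antisymm hKq ?_
    by_contra hlt
    have h3 : #A * δ1 ≤ q * δ1 := Nat.mul_le_mul_right _ hAq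
    have h4 : #K * δ2 < q * δ2 := Nat.mul_lt_mul_of_pos_right (not_le.mp hlt) h2
    rw [mul_add] at hsum
    omega
  have hAK : K = A := eq_of_subset_of_card_le hKA (by omega)
  subst hAK
  have hsurj : Set.SurjOn (fun i => (S i).1) K (univ : Finset (Fin q)) := by
    intro v _
    have hpos : #{i ∈ K | (S i).1 = v} ≠ 0 := by
      intro h0
      have := hx v
      rw [h0] at this
      omega
    obtain ⟨i, hi⟩ := card_ne_zero.mp hpos
    rw [mem_filter] at hi
    exact ⟨i, hi.1, hi.2⟩
  have hinj := injOn_of_surjOn_of_card_le (s := K) (t := univ) (fun i => (S i).1)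
    (fun _ _ => mem_coe.mpr (mem_univ _)) hsurj (by simp [hK_eq])
  have hone : ∀ π : Fin t → Fin q, (∀ v, #{i ∈ K | π i = v} ≤ 1) →
      ∀ i ∈ K, ∀ j ∈ K, i ≠ j → π i ≠ π j := by
    intro π hπ i hi j hj hij he
    exact hij (card_le_one.mp (hπ (π j)) i (by simp [hi, he]) j (by simp [hj]))
  exact ⟨hK_eq, fun i hi j hj hij => ⟨fun he => hij (hinj hi hj he),
    hone _ hA i hi j hj hij, hone _ hK i hi j hj hij⟩⟩

open Finset in
theorem card_fiber_eq_one {q t : ℕ} {K : Finset (Fin t)} (hK : #K = q) (π : Fin t → Fin q)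
    (hπ : ∀ i ∈ K, ∀ j ∈ K, i ≠ j → π i ≠ π j) (v : Fin q) : #{i ∈ K | π i = v} = 1 := by
  have hinj : Set.InjOn π K := fun i hi j hj he => by
    by_contra hij
    exact hπ i hi j hj hij he
  have himg : K.image π = univ := by
    rw [← card_eq_iff_eq_univ, card_image_of_injOn hinj, hK, Fintype.card_fin]
  obtain ⟨i, hi, rfl⟩ := mem_image.mp (himg ▸ mem_univ v)
  refine card_eq_one.mpr ⟨i, ?_⟩
  ext j
  simp only [mem_filter, mem_singleton]
  exact ⟨fun h => hinj h.1 hi h.2, by rintro rfl; exact ⟨hi, rfl⟩⟩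

/-- the `p`-valued construction (Reduction 2, case `u = 1`), where the
scoring vector of length `m` has `p ≥ 3` distinct values `a 0 > a 1 > … > a (p−1)` with
multiplicities `ℓ`, the largest value having multiplicity `ℓ 0 = 3q`.  In each
`p'ᵢ = C⃗'ᵢ ≻ x_{i₁} ≻ y_{i₂} ≻ H⃗₁ ≻ z_{i₃} ≻ H⃗'` (with `c` preceding `w` in `C⃗'ᵢ`),
`x_{i₁}` is at the (0-indexed) position `3q−1` (the last position of value `a 0`),
`y_{i₂}` at position `3q` (the first of value `a 1`), `z_{i₃}` at the first position of
value `a 2`, and `pᵢ` is the partial chain obtained by deleting `x_{i₁}`.  With `Q`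
satisfying the stated score conditions relative to `λ = s(P'∪Q, c)`, the candidate `c`
is a possible winner of `P ∪ Q` under `s` iff the 3DM instance is positive. -/
theorem stmt11 (q t p m n1 n2 : ℕ) (hq : 1 ≤ q) (hp : 3 ≤ p)
    (a : Fin p → ℕ) (haAnti : StrictAnti a)
    (ℓ : Fin p → ℕ) (hℓ : ∀ j, 1 ≤ ℓ j)
    (hℓ0 : ℓ ⟨0, by omega⟩ = 3 * q)
    (hn1 : n1 + 1 = ℓ ⟨1, by omega⟩)
    (hn2 : n2 + n1 + 3 * q + 2 = m)
    (hm : m = prefL p ℓ p)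
    (s : Fin m → ℕ)
    (hs : ∀ (pos : Fin m) (j : Fin p),
      prefL p ℓ (j : ℕ) ≤ (pos : ℕ) → (pos : ℕ) < prefL p ℓ ((j : ℕ) + 1) → s pos = a j)
    (S : Fin t → Fin q × Fin q × Fin q)
    (p' : Fin t → (Cand2 q n1 n2 ≃ Fin m))
    (hxpos : ∀ i, (p' i (Cand2.x (S i).1)).val + 1 = 3 * q)
    (hypos : ∀ i, (p' i (Cand2.y (S i).2.1)).val = 3 * q)
    (hh1pos : ∀ i k, 3 * q < (p' i (Cand2.h1 k)).val ∧
      (p' i (Cand2.h1 k)).val < 3 * q + ℓ ⟨1, by omega⟩)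
    (hzpos : ∀ i, (p' i (Cand2.z (S i).2.2)).val = 3 * q + ℓ ⟨1, by omega⟩)
    (hh2pos : ∀ i k, 3 * q + ℓ ⟨1, by omega⟩ < (p' i (Cand2.h2 k)).val)
    (hcw : ∀ i, p' i Cand2.c < p' i Cand2.w)
    (Q : List (Cand2 q n1 n2 ≃ Fin m))
    (lam : ℕ) (hlam : score s (List.ofFn p' ++ Q) Cand2.c = lam)
    (hX : ∀ ix : Fin q, score s (List.ofFn p' ++ Q) (Cand2.x ix) + a ⟨2, by omega⟩ =
      lam + a ⟨0, by omega⟩)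
    (hY : ∀ iy : Fin q, score s (List.ofFn p' ++ Q) (Cand2.y iy) + a ⟨0, by omega⟩ =
      lam + a ⟨1, by omega⟩)
    (hZ : ∀ iz : Fin q, score s (List.ofFn p' ++ Q) (Cand2.z iz) + a ⟨1, by omega⟩ =
      lam + a ⟨2, by omega⟩)
    (hH1 : ∀ k, score s (List.ofFn p' ++ Q) (Cand2.h1 k) = lam)
    (hH2 : ∀ k, score s (List.ofFn p' ++ Q) (Cand2.h2 k) = lam)
    (hW : score s (List.ofFn p' ++ Q) Cand2.w < lam) :
    (∃ T : Fin t → (Cand2 q n1 n2 ≃ Fin m),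
      (∀ (i : Fin t) (u v : Cand2 q n1 n2),
        u ≠ Cand2.x (S i).1 → v ≠ Cand2.x (S i).1 →
        p' i u < p' i v → T i u < T i v) ∧
      ∀ c', score s (List.ofFn T ++ Q) c' ≤ score s (List.ofFn T ++ Q) Cand2.c) ↔
    (∃ K : Finset (Fin t), K.card = q ∧
      ∀ i ∈ K, ∀ j ∈ K, i ≠ j →
        (S i).1 ≠ (S j).1 ∧ (S i).2.1 ≠ (S j).2.1 ∧ (S i).2.2 ≠ (S j).2.2) := by
  classical
  have hb := hasTopBlocks_of_blocks hp haAnti hℓ hm hs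
  rw [hℓ0] at hb
  have hm' : n2 + n1 + 3 * q + 2 = m := hn2
  have hgt1 := hb.fst_gt
  have hgt2 := hb.snd_gt
  have h12 := hb.lt12
  have hvote : ∀ i, IsTripleVote (p' i) (3 * q) (3 * q + ℓ ⟨1, by omega⟩)
      (S i).1 (S i).2.1 (S i).2.2 := fun i =>
    ⟨hxpos i, hypos i, hh1pos i, hzpos i, hh2pos i⟩
  generalize a ⟨0, by omega⟩ = a0 at *
  generalize a ⟨1, by omega⟩ = a1 at *
  generalize a ⟨2, by omega⟩ = a2 at *
  generalize 3 * q + ℓ ⟨1, by omega⟩ + ℓ ⟨2, by omega⟩ = b3 at *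
  generalize 3 * q + ℓ ⟨1, by omega⟩ = b2 at *
  simp only [score_ofFn_append] at *
  have hcount : ∀ (B : Finset (Fin t)) (π : Fin t → Fin q) (v : Fin q) (δ : ℕ)
      (P : Fin t → Prop) [DecidablePred P], (∀ i, i ∈ B ↔ P i) →
      ∑ i, (if P i ∧ π i = v then δ else 0) = (B.filter fun i => π i = v).card * δ := by
    intro B π v δ P _ hB
    rw [← Finset.sum_filter, Finset.sum_const, smul_eq_mul]
    congr 2
    ext i
    simp [hB]
  constructor
  · rintro ⟨T, hT, hwin⟩
    have hc : ∀ i, IsTripleVote.Completes (p' i) (T i) (S i).1 := hT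
    have hC : ∑ i, s (T i Cand2.c) = ∑ i, s (p' i Cand2.c) :=
      Finset.sum_congr rfl fun i _ => IsTripleVote.value_c hb (hvote i) hm' (hc i)
    rw [hC, hlam] at hwin
    have hx3 : ∀ i, (T i (Cand2.x (S i).1)).val < b3 := by
      refine fun i => IsTripleVote.pos_x_lt hb (hvote i) hm' (hc i) fun k => ?_
      have hle : ∑ i, s (T i (Cand2.h2 k)) ≤ ∑ i, s (p' i (Cand2.h2 k)) := by
        have e1 := hwin (Cand2.h2 k)
        have e2 := hH2 k
        omega
      by_contra hlt
      have := Finset.sum_lt_sum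
        (fun i _ => IsTripleVote.value_h2_le hb (hvote i) (hc i) k)
        ⟨i, Finset.mem_univ i, not_le.mp hlt⟩
      omega
    let A : Finset (Fin t) := {i | 3 * q ≤ (T i (Cand2.x (S i).1)).val}
    let K : Finset (Fin t) := {i | b2 ≤ (T i (Cand2.x (S i).1)).val}
    have hA : ∀ i, i ∈ A ↔ 3 * q ≤ (T i (Cand2.x (S i).1)).val := by simp [A]
    have hK : ∀ i, i ∈ K ↔ b2 ≤ (T i (Cand2.x (S i).1)).val := by simp [K]
    refine ⟨K, isMatching_of_weights (δ1 := a0 - a1) (δ2 := a1 - a2) (by omega) (by omega) S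
      (A := A) (fun i hi => (hA i).mpr (by have := (hK i).mp hi; omega)) ?_ ?_ ?_⟩
    · intro v
      have e1 := hwin (Cand2.y v)
      have e2 := hY v
      rw [Finset.sum_congr rfl fun i _ => IsTripleVote.value_y hb (hvote i) hm' (hc i) v,
        Finset.sum_add_distrib, hcount A (fun i => (S i).2.1) v _ _ hA] at e1
      refine Nat.le_of_mul_le_mul_right (c := a0 - a1) ?_ (by omega)
      omega
    · intro v
      have e1 := hwin (Cand2.z v)
      have e2 := hZ v
      rw [Finset.sum_congr rfl fun i _ => IsTripleVote.value_z hb (hvote i) hm' (hc i) v,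
        Finset.sum_add_distrib, hcount K (fun i => (S i).2.2) v _ _ hK] at e1
      refine Nat.le_of_mul_le_mul_right (c := a1 - a2) ?_ (by omega)
      omega
    · intro v
      have e1 := hwin (Cand2.x v)
      have e2 := hX v
      rw [← Finset.sum_congr rfl fun i _ =>
          IsTripleVote.value_x hb (hvote i) hm' (hc i) (hx3 i) v,
        Finset.sum_add_distrib, Finset.sum_add_distrib, hcount A (fun i => (S i).1) v _ _ hA,
        hcount K (fun i => (S i).1) v _ _ hK] at e2
      omega
  · rintro ⟨K, hKq, hKS⟩
    have hex : ∀ i, ∃ g : Cand2 q n1 n2 ≃ Fin m,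
        (g (Cand2.x (S i).1)).val = (if i ∈ K then b2 else (p' i (Cand2.x (S i).1)).val) ∧
          IsTripleVote.Completes (p' i) g (S i).1 := by
      intro i
      by_cases hi : i ∈ K
      · have hx := hxpos i
        have hz := hzpos i
        obtain ⟨g, hgx, hg⟩ := exists_move_back (p' i) (Cand2.x (S i).1)
          (p' i (Cand2.z (S i).2.2)) (by rw [Fin.le_def]; omega)
        exact ⟨g, by rw [hgx, hz, if_pos hi], hg⟩
      · exact ⟨p' i, by rw [if_neg hi], fun _ _ _ _ h => h⟩
    choose T hTx hc using hex
    have hA : ∀ i, i ∈ K ↔ 3 * q ≤ (T i (Cand2.x (S i).1)).val := by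
      intro i
      have hx := hxpos i
      rw [hTx i]
      split_ifs with hi
      · simp only [hi, true_iff]
        omega
      · simp only [hi, false_iff]
        omega
    have hK : ∀ i, i ∈ K ↔ b2 ≤ (T i (Cand2.x (S i).1)).val := by
      intro i
      have hx := hxpos i
      rw [hTx i]
      split_ifs with hi
      · simp [hi]
      · simp only [hi, false_iff]
        omega
    have hle : ∀ i, (T i (Cand2.x (S i).1)).val ≤ b2 := by
      intro i
      have hx := hxpos i
      rw [hTx i]
      split_ifs <;> omega
    refine ⟨T, hc, ?_⟩
    have hC : ∑ i, s (T i Cand2.c) = ∑ i, s (p' i Cand2.c) :=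
      Finset.sum_congr rfl fun i _ => IsTripleVote.value_c hb (hvote i) hm' (hc i)
    rw [hC, hlam]
    rintro (v | v | v | _ | _ | k | k)
    · have e2 := hX v
      rw [← Finset.sum_congr rfl fun i _ =>
          IsTripleVote.value_x hb (hvote i) hm' (hc i) ((hle i).trans_lt hb.lt23) v,
        Finset.sum_add_distrib, Finset.sum_add_distrib, hcount K (fun i => (S i).1) v _ _ hA,
        hcount K (fun i => (S i).1) v _ _ hK,
        card_fiber_eq_one hKq _ fun i hi j hj hij => (hKS i hi j hj hij).1] at e2
      omega
    · have e2 := hY v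
      rw [Finset.sum_congr rfl fun i _ => IsTripleVote.value_y hb (hvote i) hm' (hc i) v,
        Finset.sum_add_distrib, hcount K (fun i => (S i).2.1) v _ _ hA,
        card_fiber_eq_one hKq _ fun i hi j hj hij => (hKS i hi j hj hij).2.1]
      omega
    · have e2 := hZ v
      rw [Finset.sum_congr rfl fun i _ => IsTripleVote.value_z hb (hvote i) hm' (hc i) v,
        Finset.sum_add_distrib, hcount K (fun i => (S i).2.2) v _ _ hK,
        card_fiber_eq_one hKq _ fun i hi j hj hij => (hKS i hi j hj hij).2.2]
      omega
    · rw [hC, hlam]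
    · rw [Finset.sum_congr rfl fun i _ => IsTripleVote.value_w hb (hvote i) hm' (hc i)]
      exact hW.le
    · rw [Finset.sum_congr rfl fun i _ => IsTripleVote.value_h1 hb (hvote i) (hc i) k, hH1 k]
    · rw [Finset.sum_congr rfl fun i _ =>
        IsTripleVote.value_h2_eq hb (hvote i) (hc i) (hle i) k, hH2 k]
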